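/- Let Ω ⊂ ℝ² be a convex bounded set with nonempty interior and let f : ℝ² → ℝ be continuous and twice differentiable at (0,0). If the quadratic form f''(0,0) is positive definite, then the zero function u ≡ 0 is a local minimum of the functional F(u) = ∫_Ω f(∇u(x,y)) dx dy on U_Ω with respect to the C¹ norm. -/

import Mathlib

open MeasureTheory Real Set Filter Asymptotics

/-- The partial derivative `u_x` (defined via the full derivative; `0` where `u` is
not differentiable). -/
noncomputable def uX (u : ℝ × ℝ → ℝ) (p : ℝ × ℝ) : ℝ := fderiv ℝ u p (1, 0)

/-- The partial derivative `u_y`. -/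
noncomputable def uY (u : ℝ × ℝ → ℝ) (p : ℝ × ℝ) : ℝ := fderiv ℝ u p (0, 1)

/-- Membership in the class `U_Ω`: continuous concave functions on `Ω`, differentiable
almost everywhere, with bounded gradient, vanishing on `∂Ω`. -/
def MemU (Ω : Set (ℝ × ℝ)) (u : ℝ × ℝ → ℝ) : Prop :=
  ContinuousOn u (closure Ω) ∧ ConcaveOn ℝ Ω u ∧
    (∀ᵐ p ∂(volume.restrict Ω), DifferentiableAt ℝ u p) ∧
    (∃ C : ℝ, ∀ p ∈ Ω, DifferentiableAt ℝ u p → ‖fderiv ℝ u p‖ ≤ C) ∧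
    (∀ p ∈ frontier Ω, u p = 0)

/-- `∫_Ω u_x² dx dy`. -/
noncomputable def Ix (Ω : Set (ℝ × ℝ)) (u : ℝ × ℝ → ℝ) : ℝ := ∫ p in Ω, (uX u p) ^ 2

/-- `∫_Ω u_y² dx dy`. -/
noncomputable def Iy (Ω : Set (ℝ × ℝ)) (u : ℝ × ℝ → ℝ) : ℝ := ∫ p in Ω, (uY u p) ^ 2

/-- The abscissa of the left vertical support line of `Ω`. -/
noncomputable def leftX (Ω : Set (ℝ × ℝ)) : ℝ := sInf (Prod.fst '' Ω)

/-- The abscissa of the right vertical support line of `Ω`. -/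
noncomputable def rightX (Ω : Set (ℝ × ℝ)) : ℝ := sSup (Prod.fst '' Ω)

/-- The vertical support line `{x = x₀}` of `Ω`, touching `Ω` at the contact point
`(x₀, p₂)`, is angular: every `(x,y) ∈ Ω` satisfies `|y - p₂| ≤ C|x - x₀|`. -/
def AngularSupportAt (Ω : Set (ℝ × ℝ)) (x₀ : ℝ) : Prop :=
  ∃ p₂ : ℝ, (x₀, p₂) ∈ closure Ω ∧ ∃ C > 0, ∀ q ∈ Ω, |q.2 - p₂| ≤ C * |q.1 - x₀|

/-- The `C¹` norm `sup |u| + sup |u_x| + sup |u_y|`, the suprema over the derivatives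
being taken over the points where they exist. -/
noncomputable def C1Norm (Ω : Set (ℝ × ℝ)) (u : ℝ × ℝ → ℝ) : ℝ :=
  sSup ((fun p => |u p|) '' Ω) +
    sSup ((fun p => |uX u p|) '' {p ∈ Ω | DifferentiableAt ℝ u p}) +
    sSup ((fun p => |uY u p|) '' {p ∈ Ω | DifferentiableAt ℝ u p})

/-- The resistance functional `F(u) = ∫_Ω f(∇u) dx dy`. -/
noncomputable def Fres (Ω : Set (ℝ × ℝ)) (f : ℝ × ℝ → ℝ) (u : ℝ × ℝ → ℝ) : ℝ :=
  ∫ p in Ω, f (uX u p, uY u p)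

/-- The zero function is a local minimum of `F` on `U_Ω` in the `C¹` norm. -/
def ZeroIsLocalMin (Ω : Set (ℝ × ℝ)) (f : ℝ × ℝ → ℝ) : Prop :=
  ∃ δ : ℝ, 0 < δ ∧ ∀ u : ℝ × ℝ → ℝ, MemU Ω u → C1Norm Ω u < δ →
    Fres Ω f (fun _ => 0) ≤ Fres Ω f u

/-- `n` is an outward normal of a support line to `Ω` at `ξ`. -/
def IsSupportDir (Ω : Set (ℝ × ℝ)) (ξ n : ℝ × ℝ) : Prop :=
  n ≠ 0 ∧ ∀ q ∈ Ω, n.1 * q.1 + n.2 * q.2 ≤ n.1 * ξ.1 + n.2 * ξ.2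

/-- `ξ` is a regular boundary point: the support line at `ξ` is unique. -/
def IsRegularPoint (Ω : Set (ℝ × ℝ)) (ξ : ℝ × ℝ) : Prop :=
  ξ ∈ frontier Ω ∧
    ∀ n m : ℝ × ℝ, IsSupportDir Ω ξ n → IsSupportDir Ω ξ m → ∃ t : ℝ, m = t • n

/-- `ξ` is a singular boundary point: `Ω` has more than one support line at `ξ`. -/
def IsSingularPoint (Ω : Set (ℝ × ℝ)) (ξ : ℝ × ℝ) : Prop :=
  ξ ∈ frontier Ω ∧
    ∃ n m : ℝ × ℝ, IsSupportDir Ω ξ n ∧ IsSupportDir Ω ξ m ∧ ¬∃ t : ℝ, m = t • n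

open scoped Topology NNReal

theorem IsOpen.subset_closure_setOf_of_ae_restrict {X : Type*} [TopologicalSpace X]
    [MeasurableSpace X] [OpensMeasurableSpace X] {μ : Measure X} [μ.IsOpenPosMeasure] {s : Set X}
    (hs : IsOpen s) {P : X → Prop} (hP : ∀ᵐ p ∂μ.restrict s, P p) : s ⊆ closure {p ∈ s | P p} := by
  rw [ae_restrict_iff' hs.measurableSet] at hP
  have h : s \ closure {p ∈ s | P p} = ∅ := by
    refine (hs.sdiff isClosed_closure).eq_empty_of_measure_zero (μ := μ) ?_
    refine measure_mono_null (fun p hp => ?_) hP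
    intro hp'
    exact hp.2 (subset_closure ⟨hp.1, hp' hp.1⟩)
  exact sdiff_eq_empty.1 h

section General

variable {E : Type*} [NormedAddCommGroup E] [NormedSpace ℝ E] {s : Set E} {u : E → ℝ}

/-- A concave function lies below its tangent hyperplanes. -/
theorem ConcaveOn.sub_le_fderiv (hu : ConcaveOn ℝ s u) {p q : E} (hp : p ∈ s) (hq : q ∈ s)
    (hd : DifferentiableAt ℝ u p) : u q - u p ≤ fderiv ℝ u p (q - p) := by
  have h := (hd.hasFDerivAt.hasLineDerivAt (q - p)).tendsto_slope_zero_right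
  refine ge_of_tendsto h ?_
  filter_upwards [Ioo_mem_nhdsGT (zero_lt_one (α := ℝ))] with t ht
  have hc := hu.2 hp hq (sub_nonneg.2 ht.2.le) ht.1.le (by ring)
  have he : (1 - t) • p + t • q = p + t • (q - p) := by module
  rw [he] at hc
  simp only [smul_eq_mul] at hc ⊢
  rw [le_inv_mul_iff₀ ht.1]
  linarith

/-- A concave function with bounded gradient is Lipschitz on the set of its points of
differentiability. -/
theorem ConcaveOn.lipschitzOnWith_setOf_differentiableAt (hu : ConcaveOn ℝ s u) {C : ℝ≥0}
    (hC : ∀ p ∈ s, DifferentiableAt ℝ u p → ‖fderiv ℝ u p‖ ≤ C) :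
    LipschitzOnWith C u {p ∈ s | DifferentiableAt ℝ u p} := by
  refine LipschitzOnWith.of_le_add_mul C fun p hp q hq => ?_
  have h1 := hu.sub_le_fderiv hq.1 hp.1 hq.2
  have h2 := (le_abs_self _).trans ((fderiv ℝ u q).le_of_opNorm_le (hC q hq.1 hq.2) (p - q))
  rw [← dist_eq_norm] at h2
  linarith

theorem exists_mem_segment_inter_frontier {p q : E} (hp : p ∈ interior s) (hq : q ∉ interior s) :
    ∃ z ∈ segment ℝ p q, z ∈ frontier s := by
  by_contra! h
  refine hq ?_
  refine (convex_segment p q).isPreconnected.subset_left_of_subset_union isOpen_interior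
    (isClosed_closure (s := s)).isOpen_compl
    (disjoint_compl_right_iff_subset.2 interior_subset_closure) (fun z hz => ?_)
    ⟨p, left_mem_segment ℝ p q, hp⟩ (right_mem_segment ℝ p q)
  by_contra hz'
  simp only [mem_union, mem_compl_iff, not_or, not_not] at hz'
  exact h z hz ⟨hz'.2, hz'.1⟩

/-- The extension by zero of a Lipschitz function vanishing on the frontier is Lipschitz. -/
theorem LipschitzOnWith.indicator_interior {C : ℝ≥0} (hu : LipschitzOnWith C u (closure s))
    (h0 : ∀ p ∈ frontier s, u p = 0) : LipschitzWith C ((interior s).indicator u) := by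
  have key : ∀ p ∈ interior s, ∀ q ∉ interior s, |u p| ≤ C * dist p q := by
    intro p hp q hq
    obtain ⟨z, hz, hzf⟩ := exists_mem_segment_inter_frontier hp hq
    have h1 := hu.dist_le_mul p (interior_subset_closure hp) z (frontier_subset_closure hzf)
    rw [h0 z hzf, Real.dist_eq, sub_zero] at h1
    have h2 := dist_add_dist_of_mem_segment hz
    refine h1.trans (mul_le_mul_of_nonneg_left ?_ C.2)
    linarith [dist_nonneg (x := z) (y := q)]
  refine LipschitzWith.of_dist_le_mul fun p q => ?_
  by_cases hp : p ∈ interior s <;> by_cases hq : q ∈ interior s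
  · simpa [hp, hq] using
      hu.dist_le_mul p (interior_subset_closure hp) q (interior_subset_closure hq)
  · simpa [hp, hq, Real.dist_eq] using key p hp q hq
  · simpa [hp, hq, Real.dist_eq, dist_comm p q] using key q hq p hp
  · simp only [indicator_of_notMem hp, indicator_of_notMem hq, dist_self]
    positivity

/-- A positive definite bilinear form in finite dimension is coercive. -/
theorem exists_pos_mul_sq_norm_le_of_posDef [FiniteDimensional ℝ E] (B : E →L[ℝ] E →L[ℝ] ℝ)
    (hpos : ∀ v : E, v ≠ 0 → 0 < B v v) : ∃ c > 0, ∀ v : E, c * ‖v‖ ^ 2 ≤ B v v := by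
  have : ProperSpace E := FiniteDimensional.proper ℝ E
  rcases subsingleton_or_nontrivial E with hE | hE
  · exact ⟨1, one_pos, fun v => by simp [Subsingleton.elim v 0]⟩
  obtain ⟨w, hw, hmin⟩ := (isCompact_sphere (0 : E) 1).exists_isMinOn
    (NormedSpace.sphere_nonempty.2 zero_le_one) (f := fun v => B v v) (by fun_prop)
  have hw0 : w ≠ 0 := by
    rintro rfl
    simp at hw
  refine ⟨B w w, hpos w hw0, fun v => ?_⟩
  rcases eq_or_ne v 0 with rfl | hv
  · simp
  have hv' : 0 < ‖v‖ := norm_pos_iff.2 hv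
  have h := hmin (show ‖v‖⁻¹ • v ∈ Metric.sphere (0 : E) 1 by
    simp [norm_smul, hv'.ne'])
  simp only [mem_ofPred_eq, map_smul, smul_apply, smul_eq_mul] at h
  calc B w w * ‖v‖ ^ 2 ≤ (‖v‖⁻¹ * (‖v‖⁻¹ * B v v)) * ‖v‖ ^ 2 := by gcongr
    _ = B v v := by field_simp

variable [MeasurableSpace E] [BorelSpace E] [FiniteDimensional ℝ E] {μ : Measure E}
  [μ.IsAddHaarMeasure]

theorem LipschitzWith.integral_lineDeriv_eq_zero {C : ℝ≥0} (hu : LipschitzWith C u)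
    (hc : HasCompactSupport u) (v : E) : ∫ x, lineDeriv ℝ u x v ∂μ = 0 := by
  have h := LipschitzWith.integral_lineDeriv_mul_eq (μ := μ)
    (LipschitzWith.const (α := E) (1 : ℝ)) hu hc (-v)
  have h1 : ∀ x : E, lineDeriv ℝ (fun _ : E => (1 : ℝ)) x (-v) = 0 := fun x => by
    rw [(differentiableAt_const (1 : ℝ)).lineDeriv_eq_fderiv]
    simp
  simpa [h1] using h.symm

/-- The gradient of a concave function vanishing on the boundary of a bounded convex set has zero
mean, provided that it is bounded. -/
theorem ConcaveOn.setIntegral_fderiv_eq_zero (hs : Convex ℝ s) (hb : Bornology.IsBounded s)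
    (hi : (interior s).Nonempty) (hu : ConcaveOn ℝ s u) (hcont : ContinuousOn u (closure s))
    (hd : ∀ᵐ p ∂μ.restrict s, DifferentiableAt ℝ u p) {C : ℝ≥0}
    (hC : ∀ p ∈ s, DifferentiableAt ℝ u p → ‖fderiv ℝ u p‖ ≤ C)
    (h0 : ∀ p ∈ frontier s, u p = 0) (v : E) : ∫ p in s, fderiv ℝ u p v ∂μ = 0 := by
  have hfr : μ (frontier s) = 0 := hs.addHaar_frontier μ
  have hres : μ.restrict (interior s) = μ.restrict s :=
    Measure.restrict_congr_set (interior_ae_eq_of_null_frontier hfr)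
  rw [← hres] at hd ⊢
  have hcl : closure {p ∈ s | DifferentiableAt ℝ u p} = closure s := by
    refine (closure_mono (sep_subset _ _)).antisymm ?_
    rw [← hs.closure_interior_eq_closure_of_nonempty_interior hi]
    exact closure_minimal ((isOpen_interior.subset_closure_setOf_of_ae_restrict hd).trans
      (closure_mono fun p hp => ⟨interior_subset hp.1, hp.2⟩)) isClosed_closure
  have hlip : LipschitzOnWith C u (closure s) := by
    rw [← hcl] at hcont ⊢
    exact (hu.lipschitzOnWith_setOf_differentiableAt hC).closure hcont
  set g := (interior s).indicator u
  have hg : LipschitzWith C g := hlip.indicator_interior h0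
  have hgc : HasCompactSupport g := HasCompactSupport.intro hb.isCompact_closure fun x hx =>
    indicator_of_notMem (fun h => hx (interior_subset_closure h)) _
  rw [← hg.integral_lineDeriv_eq_zero (μ := μ) hgc v]
  refine Eq.trans ?_
    (setIntegral_eq_integral_of_ae_compl_eq_zero (s := interior s) (μ := μ) ?_)
  · refine integral_congr_ae ?_
    filter_upwards [hd, ae_restrict_mem isOpen_interior.measurableSet] with p hp hps
    have he : g =ᶠ[𝓝 p] u := by
      filter_upwards [isOpen_interior.mem_nhds hps] with q hq using indicator_of_mem hq _
    rw [he.lineDeriv_eq, hp.lineDeriv_eq_fderiv]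
  · filter_upwards [measure_eq_zero_iff_ae_notMem.1 hfr] with p hp hps
    have he : g =ᶠ[𝓝 p] fun _ => 0 := by
      have hpc : p ∈ (closure s)ᶜ := fun h => hp ⟨h, hps⟩
      filter_upwards [isClosed_closure.isOpen_compl.mem_nhds hpc] with q hq
      exact indicator_of_notMem (fun h => hq (interior_subset_closure h)) _
    rw [he.lineDeriv_eq, (differentiableAt_const (0 : ℝ)).lineDeriv_eq_fderiv]
    simp

end General

theorem exists_forall_norm_lt_add_le (f : ℝ × ℝ → ℝ)
    (L : ℝ × ℝ →L[ℝ] ℝ) (B : ℝ × ℝ →L[ℝ] ℝ × ℝ →L[ℝ] ℝ)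
    (hTaylor : (fun ζ : ℝ × ℝ => f ζ - f 0 - L ζ - (1 / 2) * B ζ ζ)
        =o[nhds (0 : ℝ × ℝ)] fun ζ : ℝ × ℝ => ‖ζ‖ ^ 2)
    (hpos : ∀ v : ℝ × ℝ, v ≠ 0 → 0 < B v v) :
    ∃ δ > 0, ∀ ζ : ℝ × ℝ, ‖ζ‖ < δ → f 0 + L ζ ≤ f ζ := by
  obtain ⟨c, hc, hB⟩ := exists_pos_mul_sq_norm_le_of_posDef B hpos
  obtain ⟨δ, hδ, h⟩ := Metric.eventually_nhds_iff.1 (hTaylor.def (half_pos hc))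
  refine ⟨δ, hδ, fun ζ hζ => ?_⟩
  have h1 := h (show dist ζ 0 < δ by simpa using hζ)
  rw [Real.norm_eq_abs, Real.norm_eq_abs, abs_of_nonneg (sq_nonneg ‖ζ‖)] at h1
  linarith [hB ζ, (abs_le.1 h1).1]

theorem abs_uX_uY_le_C1Norm {Ω : Set (ℝ × ℝ)} {u : ℝ × ℝ → ℝ} (hu : MemU Ω u) {p : ℝ × ℝ}
    (hp : p ∈ Ω) (hd : DifferentiableAt ℝ u p) :
    |uX u p| ≤ C1Norm Ω u ∧ |uY u p| ≤ C1Norm Ω u := by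
  obtain ⟨-, -, -, ⟨C, hC⟩, -⟩ := hu
  have hb : ∀ v : ℝ × ℝ, ‖v‖ ≤ 1 → ∀ q ∈ Ω, DifferentiableAt ℝ u q → |fderiv ℝ u q v| ≤ C :=
    fun v hv q hq hqd => ((fderiv ℝ u q).le_opNorm_of_le hv).trans (by simpa using hC q hq hqd)
  have hX : |uX u p| ≤ sSup ((fun p => |uX u p|) '' {p ∈ Ω | DifferentiableAt ℝ u p}) :=
    le_csSup ⟨C, by rintro _ ⟨q, hq, rfl⟩; exact hb _ (by simp) q hq.1 hq.2⟩ ⟨p, ⟨hp, hd⟩, rfl⟩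
  have hY : |uY u p| ≤ sSup ((fun p => |uY u p|) '' {p ∈ Ω | DifferentiableAt ℝ u p}) :=
    le_csSup ⟨C, by rintro _ ⟨q, hq, rfl⟩; exact hb _ (by simp) q hq.1 hq.2⟩ ⟨p, ⟨hp, hd⟩, rfl⟩
  have h0 : 0 ≤ sSup ((fun p => |u p|) '' Ω) :=
    Real.sSup_nonneg (by rintro _ ⟨q, -, rfl⟩; exact abs_nonneg _)
  have hX0 := (abs_nonneg _).trans hX
  have hY0 := (abs_nonneg _).trans hY
  unfold C1Norm
  constructor <;> linarith

/-- If `f''(0,0)` is positive definite then `u ≡ 0` is a local minimum of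
`F(u) = ∫_Ω f(∇u)` on `U_Ω` in the `C¹` norm. -/
theorem stmt3 (Ω : Set (ℝ × ℝ)) (hconv : Convex ℝ Ω) (hbdd : Bornology.IsBounded Ω)
    (hint : (interior Ω).Nonempty) (f : ℝ × ℝ → ℝ) (hf : Continuous f)
    (L : ℝ × ℝ →L[ℝ] ℝ) (B : ℝ × ℝ →L[ℝ] ℝ × ℝ →L[ℝ] ℝ)
    (hsymm : ∀ v w : ℝ × ℝ, B v w = B w v)
    (hTaylor : (fun ζ : ℝ × ℝ => f ζ - f 0 - L ζ - (1 / 2) * B ζ ζ)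
        =o[nhds (0 : ℝ × ℝ)] fun ζ : ℝ × ℝ => ‖ζ‖ ^ 2)
    (hpos : ∀ v : ℝ × ℝ, v ≠ 0 → 0 < B v v) :
    ZeroIsLocalMin Ω f := by
  obtain ⟨δ, hδ, hle⟩ := exists_forall_norm_lt_add_le f L B hTaylor hpos
  refine ⟨δ, hδ, fun u hu hnorm => ?_⟩
  have hgrad : ∀ᵐ p ∂(volume.restrict Ω), ‖(uX u p, uY u p)‖ < δ := by
    filter_upwards [hu.2.2.1, ae_restrict_mem₀ (hconv.nullMeasurableSet volume)] with p hd hp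
    obtain ⟨hX, hY⟩ := abs_uX_uY_le_C1Norm hu hp hd
    exact max_lt (hX.trans_lt hnorm) (hY.trans_lt hnorm)
  have : IsFiniteMeasure (volume.restrict Ω) := ⟨by simpa using hbdd.measure_lt_top⟩
  have hmeas : Measurable fun p => (uX u p, uY u p) :=
    (measurable_fderiv_apply_const ℝ u _).prodMk (measurable_fderiv_apply_const ℝ u _)
  have hintegrable : ∀ g : ℝ × ℝ → ℝ, Continuous g →
      Integrable (fun p => g (uX u p, uY u p)) (volume.restrict Ω) := by
    intro g hg
    obtain ⟨M, hM⟩ :=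
      (isCompact_closedBall (0 : ℝ × ℝ) δ).exists_bound_of_continuousOn hg.continuousOn
    refine Integrable.of_bound (hg.measurable.comp hmeas).aestronglyMeasurable M ?_
    filter_upwards [hgrad] with p hp using hM _ (by simpa using hp.le)
  obtain ⟨hcont, hconc, hd, ⟨C, hC⟩, h0⟩ := hu
  have hzero : ∀ v, ∫ p in Ω, fderiv ℝ u p v = 0 :=
    hconc.setIntegral_fderiv_eq_zero hconv hbdd hint hcont hd (C := C.toNNReal)
      (fun p hp hp' => (hC p hp hp').trans (Real.le_coe_toNNReal C)) h0
  have hL : ∫ p in Ω, L (uX u p, uY u p) = 0 := by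
    have hsplit : ∀ p, L (uX u p, uY u p) = L (1, 0) * uX u p + L (0, 1) * uY u p := fun p => by
      have : (uX u p, uY u p) = uX u p • ((1, 0) : ℝ × ℝ) + uY u p • ((0, 1) : ℝ × ℝ) := by simp
      rw [this, map_add, map_smul, map_smul, smul_eq_mul, smul_eq_mul]
      ring
    simp_rw [hsplit]
    rw [integral_add ((hintegrable _ continuous_fst).const_mul _)
      ((hintegrable _ continuous_snd).const_mul _), integral_const_mul, integral_const_mul]
    simp [uX, uY, hzero]
  calc Fres Ω f (fun _ => 0) = ∫ _ in Ω, f 0 := by simp [Fres, uX, uY, Prod.zero_eq_mk]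
    _ = ∫ p in Ω, (f 0 + L (uX u p, uY u p)) := by
      rw [integral_add (integrable_const _) (hintegrable L L.continuous), hL, add_zero]
    _ ≤ Fres Ω f u := by
      refine integral_mono_ae ((integrable_const _).add (hintegrable L L.continuous))
        (hintegrable f hf) ?_
      filter_upwards [hgrad] with p hp using hle _ hp
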